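/- Let q be a prime power, let P = (p₁, …, p_k) be a probability vector with rational entries and all p_i > 0, and let N_P be the set of positive integers n such that n·p_i ∈ ℤ for all i. For n ∈ N_P, let c(n) denote the number of isotropic flags of type (np₁, …, np_{k−1}) in 𝔽_q^{2n} equipped with the standard symplectic form. Then the limit, as n → ∞ with n ∈ N_P, of (1/n²)·log_q c(n) equals (1/2)·H₂(P) + (1/2)·(1 − p_k²), where H₂(P) = 1 − Σ_{i=1}^k p_i² is the Tsallis 2-entropy. -/

import Mathlib

open Matrix

/-- The standard symplectic structure matrix `J = [[0, -1ₙ],[1ₙ, 0]]` on `F^{2n} = F^n ⊕ F^n`. -/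
def stdJ (n : ℕ) (F : Type*) [Field F] :
    Matrix (Fin n ⊕ Fin n) (Fin n ⊕ Fin n) F :=
  Matrix.fromBlocks 0 (-1) 1 0

/-- The standard symplectic form `⟨x, y⟩ = xᵀ J y` on `F^{2n}`. -/
def stdSymplForm {n : ℕ} {F : Type*} [Field F] (x y : Fin n ⊕ Fin n → F) : F :=
  x ⬝ᵥ ((stdJ n F) *ᵥ y)

/-- A matrix `g` is symplectic if it is invertible and preserves the standard symplectic
form: `⟨g u, g v⟩ = ⟨u, v⟩` for all `u`, `v`. -/
def IsSymplectic {n : ℕ} {F : Type*} [Field F]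
    (g : Matrix (Fin n ⊕ Fin n) (Fin n ⊕ Fin n) F) : Prop :=
  IsUnit g ∧ ∀ u v, stdSymplForm (g *ᵥ u) (g *ᵥ v) = stdSymplForm u v

/-- A subspace is totally isotropic if the standard symplectic form vanishes identically
on it. -/
def IsTotallyIsotropic {n : ℕ} {F : Type*} [Field F]
    (S : Submodule F (Fin n ⊕ Fin n → F)) : Prop :=
  ∀ u ∈ S, ∀ v ∈ S, stdSymplForm u v = 0

open Filter

section Counting

variable {K V : Type*} [Field K] [AddCommGroup V] [Module K V]

/-- Linearly independent tuples whose `j`-th entry is constrained to lie in a subspace that may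
depend on `j` and on the span of the preceding entries. -/
def constrainedTuples (U : ℕ → Submodule K V → Submodule K V) (m : ℕ) : Set (Fin m → V) :=
  {v | LinearIndependent K v ∧ ∀ j : Fin m, v j ∈ U j (Submodule.span K (v '' Set.Iio j))}

theorem snoc_mem_constrainedTuples {U : ℕ → Submodule K V → Submodule K V} {m : ℕ}
    {v : Fin m → V} {x : V} :
    (Fin.snoc v x : Fin (m + 1) → V) ∈ constrainedTuples U (m + 1) ↔
      v ∈ constrainedTuples U m ∧
        x ∈ ((U m (Submodule.span K (Set.range v)) : Set V) \ Submodule.span K (Set.range v)) := by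
  have hlast : (Fin.snoc v x : Fin (m + 1) → V) '' Set.Iio (Fin.last m) = Set.range v := by
    ext y
    simp only [Set.mem_image, Set.mem_Iio, Set.mem_range]
    constructor
    · rintro ⟨i, hi, rfl⟩
      obtain ⟨i, rfl⟩ := Fin.exists_castSucc_eq.2 hi.ne
      exact ⟨i, by simp⟩
    · rintro ⟨i, rfl⟩
      exact ⟨i.castSucc, Fin.castSucc_lt_last i, by simp⟩
  have hcast (j : Fin m) : (Fin.snoc v x : Fin (m + 1) → V) '' Set.Iio j.castSucc =
      v '' Set.Iio j := by
    ext y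
    simp only [Set.mem_image, Set.mem_Iio]
    constructor
    · rintro ⟨i, hi, rfl⟩
      obtain ⟨i, rfl⟩ := Fin.exists_castSucc_eq.2 (hi.trans (Fin.castSucc_lt_last j)).ne
      exact ⟨i, by simpa using hi, by simp⟩
    · rintro ⟨i, hi, rfl⟩
      exact ⟨i.castSucc, by simpa using hi, by simp⟩
  simp only [constrainedTuples, Set.mem_ofPred_eq, linearIndependent_finSnoc, Fin.forall_fin_succ',
    hlast, hcast, Fin.snoc_castSucc, Fin.snoc_last, Fin.val_castSucc, Fin.val_last, Set.mem_sdiff,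
    SetLike.mem_coe]
  tauto

/-- Splitting off the last entry of a constrained tuple. -/
def constrainedTuplesSuccEquiv (U : ℕ → Submodule K V → Submodule K V) (m : ℕ) :
    constrainedTuples U (m + 1) ≃ Σ v : constrainedTuples U m,
      ↥((U m (Submodule.span K (Set.range v.1)) : Set V) \ Submodule.span K (Set.range v.1)) where
  toFun w :=
    have h := snoc_mem_constrainedTuples.1
      (show (Fin.snoc (Fin.init w.1) (w.1 (Fin.last m)) : Fin (m + 1) → V) ∈ _ by
        rw [Fin.snoc_init_self]; exact w.2)
    ⟨⟨Fin.init w.1, h.1⟩, ⟨w.1 (Fin.last m), h.2⟩⟩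
  invFun p := ⟨Fin.snoc p.1.1 p.2.1, snoc_mem_constrainedTuples.2 ⟨p.1.2, p.2.2⟩⟩
  left_inv w := by simp
  right_inv := by
    rintro ⟨⟨v, hv⟩, x, hx⟩
    have h1 : Fin.init (Fin.snoc v x : Fin (m + 1) → V) = v := Fin.init_snoc _ _
    have h2 : (Fin.snoc v x : Fin (m + 1) → V) (Fin.last m) = x := Fin.snoc_last _ _
    refine Sigma.ext (Subtype.ext h1) ?_
    dsimp only
    congr! 1
    simp

theorem natCard_constrainedTuples [Finite K] [Finite V] (U : ℕ → Submodule K V → Submodule K V)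
    (e : ℕ → ℕ) (m : ℕ)
    (hle : ∀ j < m, ∀ v ∈ constrainedTuples U j,
      Submodule.span K (Set.range v) ≤ U j (Submodule.span K (Set.range v)))
    (he : ∀ j < m, ∀ v ∈ constrainedTuples U j,
      Module.finrank K (U j (Submodule.span K (Set.range v))) = e j) :
    Nat.card (constrainedTuples U m) =
      ∏ j ∈ Finset.range m, (Nat.card K ^ e j - Nat.card K ^ j) := by
  induction m with
  | zero =>
    have : constrainedTuples U 0 = Set.univ :=
      Set.eq_univ_of_forall fun v => ⟨linearIndependent_empty_type, fun j => j.elim0⟩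
    simp [this]
  | succ m ih =>
    have hm (v : constrainedTuples U m) :
        Nat.card ↥((U m (Submodule.span K (Set.range v.1)) : Set V) \
          Submodule.span K (Set.range v.1)) = Nat.card K ^ e m - Nat.card K ^ m := by
      rw [Nat.card_coe_set_eq, Set.ncard_sdiff (hle m m.lt_succ_self v.1 v.2),
        ← Nat.card_coe_set_eq, ← Nat.card_coe_set_eq]
      simp only [SetLike.coe_sort_coe]
      rw [Module.natCard_eq_pow_finrank (K := K) (V := U m _),
        Module.natCard_eq_pow_finrank (K := K) (V := Submodule.span K _), he m m.lt_succ_self v.1 v.2, finrank_span_eq_card v.2.1, Fintype.card_fin]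
    have := Fintype.ofFinite (constrainedTuples U m)
    rw [Nat.card_congr (constrainedTuplesSuccEquiv U m), Nat.card_sigma,
      Finset.sum_congr rfl fun v _ => hm v, Finset.sum_const, Finset.card_univ,
      ← Nat.card_eq_fintype_card, smul_eq_mul,
      ih (fun j hj => hle j (hj.trans m.lt_succ_self)) (fun j hj => he j (hj.trans m.lt_succ_self)),
      Finset.prod_range_succ]

end Counting

section SymplecticForm

variable {F : Type*} [Field F] {n : ℕ}

theorem toBilin'_stdJ_apply (x y : Fin n ⊕ Fin n → F) :
    Matrix.toBilin' (stdJ n F) x y = stdSymplForm x y :=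
  Matrix.toBilin'_apply' _ _ _

theorem nondegenerate_stdJ : (Matrix.toBilin' (stdJ n F)).Nondegenerate :=
  LinearMap.BilinForm.nondegenerate_toBilin'_of_det_ne_zero' _
    (Matrix.isUnit_det_J (Fin n) F).ne_zero

theorem stdSymplForm_self (x : Fin n ⊕ Fin n → F) : stdSymplForm x x = 0 := by
  obtain ⟨a, b, rfl⟩ : ∃ a b, x = Sum.elim a b := ⟨_, _, (Sum.elim_comp_inl_inr x).symm⟩
  rw [stdSymplForm, stdJ, Matrix.fromBlocks_mulVec]
  simp [sumElim_dotProduct_sumElim, neg_mulVec, dotProduct_comm]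

theorem isAlt_stdJ : (Matrix.toBilin' (stdJ n F)).IsAlt := fun x => by
  rw [toBilin'_stdJ_apply, stdSymplForm_self]

theorem isTotallyIsotropic_iff_le_orthogonal {S : Submodule F (Fin n ⊕ Fin n → F)} :
    IsTotallyIsotropic S ↔ S ≤ (Matrix.toBilin' (stdJ n F)).orthogonal S := by
  simp only [IsTotallyIsotropic, SetLike.le_def, LinearMap.BilinForm.mem_orthogonal_iff,
    ← toBilin'_stdJ_apply]
  tauto

theorem isTotallyIsotropic_span_range {ι : Type*} {v : ι → Fin n ⊕ Fin n → F} :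
    IsTotallyIsotropic (Submodule.span F (Set.range v)) ↔ ∀ i j, stdSymplForm (v i) (v j) = 0 := by
  refine ⟨fun h i j => h _ (Submodule.subset_span ⟨i, rfl⟩) _ (Submodule.subset_span ⟨j, rfl⟩),
    fun h u hu w hw => ?_⟩
  simp only [← toBilin'_stdJ_apply] at h ⊢
  induction hu, hw using Submodule.span_induction₂ with
  | mem_mem x y hx hy =>
    obtain ⟨i, rfl⟩ := hx
    obtain ⟨j, rfl⟩ := hy
    exact h i j
  | zero_left y hy => simp
  | zero_right x hx => simp
  | add_left x y z _ _ _ h1 h2 => simp [h1, h2]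
  | add_right x y z _ _ _ h1 h2 => simp [h1, h2]
  | smul_left r x y _ _ h1 => simp [h1]
  | smul_right r x y _ _ h1 => simp [h1]

theorem mem_constrainedTuples_orthogonal {m : ℕ} {v : Fin m → Fin n ⊕ Fin n → F} :
    v ∈ constrainedTuples (fun _ => (Matrix.toBilin' (stdJ n F)).orthogonal) m ↔
      LinearIndependent F v ∧ IsTotallyIsotropic (Submodule.span F (Set.range v)) := by
  rw [isTotallyIsotropic_span_range]
  simp only [← toBilin'_stdJ_apply]
  refine and_congr_right fun _ => ⟨fun h => ?_, fun h j => ?_⟩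
  · have key (i j : Fin m) (hij : i < j) : Matrix.toBilin' (stdJ n F) (v i) (v j) = 0 :=
      LinearMap.BilinForm.mem_orthogonal_iff.1 (h j) _ (Submodule.subset_span ⟨i, hij, rfl⟩)
    intro i j
    rcases lt_trichotomy i j with hij | rfl | hij
    · exact key i j hij
    · exact isAlt_stdJ.self_eq_zero _
    · exact isAlt_stdJ.isRefl _ _ (key j i hij)
  · rw [LinearMap.BilinForm.mem_orthogonal_iff]
    intro x hx
    induction hx using Submodule.span_induction with
    | mem x hx => obtain ⟨i, -, rfl⟩ := hx; exact h i j
    | zero => simp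
    | add x y _ _ h1 h2 => simp_all
    | smul r x _ h1 => simp_all

/-- The number of linearly independent tuples of length `m` spanning a totally isotropic
subspace. -/
theorem natCard_isotropic_tuples [Finite F] (m : ℕ) :
    Nat.card {v : Fin m → Fin n ⊕ Fin n → F |
      LinearIndependent F v ∧ IsTotallyIsotropic (Submodule.span F (Set.range v))} =
      ∏ j ∈ Finset.range m, (Nat.card F ^ (2 * n - j) - Nat.card F ^ j) := by
  rw [← natCard_constrainedTuples (fun _ => (Matrix.toBilin' (stdJ n F)).orthogonal)]
  · congr! 2
    ext v
    exact mem_constrainedTuples_orthogonal.symm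
  · intro j _ v hv
    exact isTotallyIsotropic_iff_le_orthogonal.1 (mem_constrainedTuples_orthogonal.1 hv).2
  · intro j _ v hv
    rw [LinearMap.BilinForm.finrank_orthogonal nondegenerate_stdJ,
      finrank_span_eq_card hv.1]
    simp [two_mul]

end SymplecticForm

section Flags

/-- The index of the block containing `j`, when `Fin (∑ i, a i)` is cut into consecutive blocks of
lengths `a i`. -/
def blockIndex {k : ℕ} (a : Fin k → ℕ) (j : Fin (∑ i, a i)) : Fin k :=
  (finSigmaFinEquiv.symm j).1

theorem sum_castLE_eq_sum_Iio {k : ℕ} (a : Fin k → ℕ) (i : Fin k) :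
    ∑ l : Fin i, a (Fin.castLE i.2.le l) = ∑ l ∈ Finset.Iio i, a l := by
  refine Finset.sum_bij (fun l _ => Fin.castLE i.2.le l) ?_ ?_ ?_ ?_
  · intro l _
    exact Finset.mem_Iio.2 (Fin.lt_def.2 l.2)
  · intro l _ l' _ h
    simpa using h
  · intro l hl
    exact ⟨⟨l, Fin.lt_def.1 (Finset.mem_Iio.1 hl)⟩, Finset.mem_univ _, rfl⟩
  · intro l _
    rfl

theorem blockIndex_le_iff {k : ℕ} (a : Fin k → ℕ) (j : Fin (∑ i, a i)) (i : Fin k) :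
    blockIndex a j ≤ i ↔ (j : ℕ) < ∑ l ∈ Finset.Iic i, a l := by
  obtain ⟨⟨b, r⟩, rfl⟩ := finSigmaFinEquiv.surjective j
  simp only [blockIndex, Equiv.symm_apply_apply, finSigmaFinEquiv_apply, sum_castLE_eq_sum_Iio]
  constructor
  · intro h
    calc ∑ l ∈ Finset.Iio b, a l + r < ∑ l ∈ Finset.Iio b, a l + a b := by have := r.2; omega
      _ = ∑ l ∈ Finset.Iic b, a l := by
        rw [← Finset.Iio_insert, Finset.sum_insert (by simp), add_comm]
      _ ≤ _ := Finset.sum_le_sum_of_subset (Finset.Iic_subset_Iic.2 h)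
  · contrapose!
    intro h
    exact (Finset.sum_le_sum_of_subset fun l hl =>
      Finset.mem_Iio.2 ((Finset.mem_Iic.1 hl).trans_lt h)).trans le_self_add

theorem sum_blockIndex {k : ℕ} (a : Fin k → ℕ) {M : Type*} [AddCommMonoid M] (f : Fin k → M) :
    ∑ j, f (blockIndex a j) = ∑ i, a i • f i := by
  rw [← finSigmaFinEquiv.sum_comp]
  simp [blockIndex, Fintype.sum_sigma]

variable {K V : Type*} [Field K] [AddCommGroup V] [Module K V] {k : ℕ}

/-- The number of bases of the largest member of a flag that are adapted to the flag. -/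
theorem natCard_adapted_tuples [Finite K] [Finite V] (a : Fin k → ℕ) (S : Fin k → Submodule K V)
    (hS : Monotone S) (hfin : ∀ i, Module.finrank K (S i) = ∑ l ∈ Finset.Iic i, a l) :
    Nat.card {v : Fin (∑ i, a i) → V | LinearIndependent K v ∧ ∀ j, v j ∈ S (blockIndex a j)} =
      ∏ j : Fin (∑ i, a i),
        (Nat.card K ^ (∑ l ∈ Finset.Iic (blockIndex a j), a l) - Nat.card K ^ (j : ℕ)) := by
  let U : ℕ → Submodule K V → Submodule K V := fun j _ =>
    if h : j < ∑ i, a i then S (blockIndex a ⟨j, h⟩) else ⊤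
  let e : ℕ → ℕ := fun j =>
    if h : j < ∑ i, a i then ∑ l ∈ Finset.Iic (blockIndex a ⟨j, h⟩), a l else 0
  have hmono : Monotone (blockIndex a) := fun j j' h =>
    (blockIndex_le_iff _ _ _).2 ((Fin.le_def.1 h).trans_lt ((blockIndex_le_iff _ _ _).1 le_rfl))
  have hU : {v : Fin (∑ i, a i) → V | LinearIndependent K v ∧ ∀ j, v j ∈ S (blockIndex a j)} =
      constrainedTuples U (∑ i, a i) := by
    ext v
    simp [constrainedTuples, U]
  rw [hU, natCard_constrainedTuples U e, Finset.prod_range]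
  · simp [e]
  · intro j hj v hv
    rw [Submodule.span_le]
    rintro _ ⟨i, rfl⟩
    have := hv.2 i
    simp only [U, i.2.trans hj, hj, dite_true, SetLike.mem_coe] at this ⊢
    exact hS (hmono (Fin.mk_le_mk.2 i.2.le)) this
  · intro j hj v hv
    have hUj : U j (Submodule.span K (Set.range v)) = S (blockIndex a ⟨j, hj⟩) := dif_pos hj
    rw [hUj, hfin]
    simp [e, hj]

/-- The flag spanned by the initial segments of a tuple. -/
def spanFlag (K : Type*) {V : Type*} [Field K] [AddCommGroup V] [Module K V] (a : Fin k → ℕ)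
    (v : Fin (∑ i, a i) → V) (i : Fin k) : Submodule K V :=
  Submodule.span K (v '' {j | blockIndex a j ≤ i})

theorem spanFlag_mono (a : Fin k → ℕ) (v : Fin (∑ i, a i) → V) : Monotone (spanFlag K a v) :=
  fun _ _ h => Submodule.span_mono (Set.image_mono fun _ hj => le_trans hj h)

theorem finrank_spanFlag (a : Fin k → ℕ) {v : Fin (∑ i, a i) → V} (hv : LinearIndependent K v)
    (i : Fin k) : Module.finrank K (spanFlag K a v i) = ∑ l ∈ Finset.Iic i, a l := by
  have hle : ∑ l ∈ Finset.Iic i, a l ≤ ∑ l, a l :=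
    Finset.sum_le_sum_of_subset (Finset.subset_univ _)
  have hli := hv.comp (fun j : {j | blockIndex a j ≤ i} => (j : Fin (∑ i, a i)))
    Subtype.val_injective
  rw [spanFlag, Set.image_eq_range]
  refine (finrank_span_eq_card hli).trans ?_
  simp only [Set.coe_ofPred, blockIndex_le_iff]
  rw [Fintype.card_congr (Fin.castLEquiv hle).symm, Fintype.card_fin]

end Flags

/-- Isotropic flags in `F^{2n}` whose successive quotients have dimensions `a i`. -/
def isotropicFlags (F : Type*) [Field F] (n : ℕ) {k : ℕ} (a : Fin k → ℕ) :
    Set (Fin k → Submodule F (Fin n ⊕ Fin n → F)) :=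
  {S | (∀ i, IsTotallyIsotropic (S i)) ∧ Monotone S ∧
    ∀ i, Module.finrank F (S i) = ∑ j ∈ Finset.Iic i, a j}

theorem natCard_isotropicFlags_mul (F : Type*) [Field F] [Finite F] (n : ℕ) {k : ℕ}
    (a : Fin k → ℕ) :
    Nat.card (isotropicFlags F n a) * ∏ j : Fin (∑ i, a i),
        (Nat.card F ^ (∑ l ∈ Finset.Iic (blockIndex a j), a l) - Nat.card F ^ (j : ℕ)) =
      ∏ j : Fin (∑ i, a i), (Nat.card F ^ (2 * n - j) - Nat.card F ^ (j : ℕ)) := by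
  let A (S : Fin k → Submodule F (Fin n ⊕ Fin n → F)) :
      Set (Fin (∑ i, a i) → Fin n ⊕ Fin n → F) :=
    {v | LinearIndependent F v ∧ ∀ j, v j ∈ S (blockIndex a j)}
  let T : Set (Fin (∑ i, a i) → Fin n ⊕ Fin n → F) :=
    {v | LinearIndependent F v ∧ IsTotallyIsotropic (Submodule.span F (Set.range v))}
  have hA (S : isotropicFlags F n a) (v : A S.1) : v.1 ∈ T := by
    refine ⟨v.2.1, isTotallyIsotropic_span_range.2 fun i j => ?_⟩
    exact S.2.1 (max (blockIndex a i) (blockIndex a j)) _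
      (S.2.2.1 (le_max_left _ _) (v.2.2 i)) _ (S.2.2.1 (le_max_right _ _) (v.2.2 j))
  have hspan (S : isotropicFlags F n a) (v : A S.1) : S.1 = spanFlag F a v.1 := by
    funext i
    refine (Submodule.eq_of_le_of_finrank_eq ?_ ?_).symm
    · rw [spanFlag, Submodule.span_le]
      rintro _ ⟨j, hj, rfl⟩
      exact S.2.2.1 hj (v.2.2 j)
    · rw [finrank_spanFlag a v.2.1, S.2.2.2]
  let f : (Σ S : isotropicFlags F n a, A S.1) → T := fun p => ⟨p.2.1, hA p.1 p.2⟩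
  have hf : Function.Bijective f := by
    constructor
    · rintro ⟨S, v⟩ ⟨S', v'⟩ h
      have hv : v.1 = v'.1 := congrArg Subtype.val h
      obtain rfl : S = S' := Subtype.ext (by rw [hspan S v, hspan S' v', hv])
      obtain rfl : v = v' := Subtype.ext hv
      rfl
    · rintro ⟨v, hv⟩
      refine ⟨⟨⟨spanFlag F a v, fun i x hx y hy => ?_, spanFlag_mono a v,
        finrank_spanFlag a hv.1⟩, ⟨v, hv.1, fun j => Submodule.subset_span ⟨j, le_refl (blockIndex a j), rfl⟩⟩⟩, rfl⟩
      exact hv.2 _ (Submodule.span_mono (Set.image_subset_range _ _) hx) _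
        (Submodule.span_mono (Set.image_subset_range _ _) hy)
  have := Fintype.ofFinite (isotropicFlags F n a)
  have hcard := Nat.card_congr (Equiv.ofBijective f hf)
  rw [Nat.card_sigma, Finset.sum_congr rfl fun S _ =>
    natCard_adapted_tuples a S.1 S.2.2.1 S.2.2.2, natCard_isotropic_tuples] at hcard
  rw [← Finset.prod_range (fun j => Nat.card F ^ (2 * n - j) - Nat.card F ^ j), ← hcard,
    Finset.sum_const, Finset.card_univ, ← Nat.card_eq_fintype_card, smul_eq_mul]

section Asymptotics

theorem logb_pow_sub_pow_le {q a b : ℕ} (hq : 2 ≤ q) (h : b < a) :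
    Real.logb q ((q ^ a - q ^ b : ℕ) : ℝ) ≤ a := by
  have hq1 : (1 : ℝ) < q := by exact_mod_cast hq
  have hlt : q ^ b < q ^ a := Nat.pow_lt_pow_right hq h
  rw [Real.logb_le_iff_le_rpow hq1 (by exact_mod_cast Nat.sub_pos_of_lt hlt), Real.rpow_natCast]
  exact_mod_cast Nat.sub_le _ _

theorem le_logb_pow_sub_pow {q a b : ℕ} (hq : 2 ≤ q) (h : b < a) :
    (a : ℝ) - 1 ≤ Real.logb q ((q ^ a - q ^ b : ℕ) : ℝ) := by
  have hq1 : (1 : ℝ) < q := by exact_mod_cast hq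
  have hlt : q ^ b < q ^ a := Nat.pow_lt_pow_right hq h
  obtain ⟨c, rfl⟩ : ∃ c, a = c + 1 := ⟨a - 1, by omega⟩
  rw [Real.le_logb_iff_rpow_le hq1 (by exact_mod_cast Nat.sub_pos_of_lt hlt), Nat.cast_succ,
    add_sub_cancel_right, Real.rpow_natCast]
  have h1 : q ^ b ≤ q ^ c := Nat.pow_le_pow_right (by omega) (by omega)
  have h2 : 2 * q ^ c ≤ q ^ (c + 1) := by rw [pow_succ']; gcongr
  exact_mod_cast (by omega : q ^ c ≤ q ^ (c + 1) - q ^ b)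

theorem two_mul_sum_mul_sum_Iic {ι R : Type*} [Fintype ι] [LinearOrder ι]
    [LocallyFiniteOrderBot ι] [CommRing R] (x : ι → R) :
    2 * ∑ i, x i * ∑ j ∈ Finset.Iic i, x j = (∑ i, x i) ^ 2 + ∑ i, x i ^ 2 := by
  have h1 : ∑ i, x i * ∑ j ∈ Finset.Iic i, x j = ∑ i, ∑ j, if j ≤ i then x i * x j else 0 := by
    refine Finset.sum_congr rfl fun i _ => ?_
    rw [Finset.mul_sum, ← Finset.sum_filter]
    congr 1
    ext j
    simp
  have h2 : ∑ i, x i * ∑ j ∈ Finset.Iic i, x j = ∑ i, ∑ j, if i ≤ j then x i * x j else 0 := by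
    rw [h1, Finset.sum_comm]
    simp only [mul_comm]
  have h3 : ∑ i, x i ^ 2 = ∑ i, ∑ j, if i = j then x i * x j else 0 := by
    simp [sq]
  rw [two_mul]
  nth_rewrite 1 [h1]
  rw [h2, h3, sq, Finset.sum_mul_sum, ← Finset.sum_add_distrib, ← Finset.sum_add_distrib]
  refine Finset.sum_congr rfl fun i _ => ?_
  rw [← Finset.sum_add_distrib, ← Finset.sum_add_distrib]
  refine Finset.sum_congr rfl fun j _ => ?_
  rcases lt_trichotomy i j with h | rfl | h
  · simp [h.le, h.ne, h.not_ge]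
  · simp
  · simp [h.le, h.ne', h.not_ge]

/-- The logarithm of the number of isotropic flags, up to a linear error. -/
theorem abs_logb_natCard_isotropicFlags_sub_le (F : Type*) [Field F] [Finite F] {n k : ℕ}
    (a : Fin k → ℕ) (ha : ∑ i, a i ≤ n) :
    |Real.logb (Nat.card F) (Nat.card (isotropicFlags F n a)) -
      (2 * n * ∑ i, (a i : ℝ) - (∑ i, (a i : ℝ)) ^ 2 - (∑ i, (a i : ℝ) ^ 2) / 2)| ≤ 2 * (n : ℝ) := by
  set q := Nat.card F
  set m := ∑ i, a i with hm
  have hq : 2 ≤ q := Finite.one_lt_card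
  let D (j : Fin m) : ℕ := ∑ l ∈ Finset.Iic (blockIndex a j), a l
  have hD (j : Fin m) : (j : ℕ) < D j := (blockIndex_le_iff a j _).1 le_rfl
  have hne {b c : ℕ} (h : b < c) : ((q ^ c - q ^ b : ℕ) : ℝ) ≠ 0 := by
    exact_mod_cast (Nat.sub_pos_of_lt (Nat.pow_lt_pow_right hq h)).ne'
  have hj (j : Fin m) : (j : ℕ) < 2 * n - j := by have := j.2; omega
  have hlog : Real.logb q (Nat.card (isotropicFlags F n a)) =
      ∑ j : Fin m, (Real.logb q ((q ^ (2 * n - j) - q ^ (j : ℕ) : ℕ) : ℝ) -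
        Real.logb q ((q ^ D j - q ^ (j : ℕ) : ℕ) : ℝ)) := by
    have hprod := congrArg (Nat.cast : ℕ → ℝ) (natCard_isotropicFlags_mul F n a)
    rw [Nat.cast_mul, Nat.cast_prod, Nat.cast_prod] at hprod
    have hc : (Nat.card (isotropicFlags F n a) : ℝ) ≠ 0 := by
      intro h0
      rw [h0, zero_mul] at hprod
      exact Finset.prod_ne_zero_iff.2 (fun j _ => hne (hj j)) hprod.symm
    have := congrArg (Real.logb q) hprod
    rw [Real.logb_mul hc (Finset.prod_ne_zero_iff.2 fun j _ => hne (hD j)),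
      Real.logb_prod _ _ (fun j _ => hne (hD j)), Real.logb_prod _ _ (fun j _ => hne (hj j))] at this
    rw [Finset.sum_sub_distrib, ← this, add_sub_cancel_right]
  have hsum : ∑ j : Fin m, ((2 * n : ℝ) - j - D j) =
      2 * n * m - ((m : ℝ) ^ 2 - m) / 2 - ((m : ℝ) ^ 2 + ∑ i, (a i : ℝ) ^ 2) / 2 := by
    have h1 : ∑ j : Fin m, (j : ℝ) = ((m : ℝ) ^ 2 - m) / 2 := by
      rw [Fin.sum_univ_eq_sum_range (fun j => (j : ℝ))]
      generalize m = N
      induction N with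
      | zero => simp
      | succ N ih => rw [Finset.sum_range_succ, ih]; push_cast; ring
    have h2 : ∑ j : Fin m, (D j : ℝ) = ((m : ℝ) ^ 2 + ∑ i, (a i : ℝ) ^ 2) / 2 := by
      have h := sum_blockIndex a fun i => ∑ l ∈ Finset.Iic i, (a l : ℝ)
      simp only [nsmul_eq_mul] at h
      have h' := two_mul_sum_mul_sum_Iic fun i => (a i : ℝ)
      simp only [D, Nat.cast_sum]
      rw [h, hm, Nat.cast_sum]
      linarith
    rw [Finset.sum_sub_distrib, Finset.sum_sub_distrib, h1, h2]
    simp [mul_comm]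
  have hbound : |Real.logb q (Nat.card (isotropicFlags F n a)) -
      ∑ j : Fin m, ((2 * n : ℝ) - j - D j)| ≤ m := by
    rw [hlog, ← Finset.sum_sub_distrib]
    refine (Finset.abs_sum_le_sum_abs _ _).trans ?_
    refine (Finset.sum_le_sum (g := fun _ => 1) fun j _ => ?_).trans (by simp)
    have h1 := logb_pow_sub_pow_le hq (hj j)
    have h2 := le_logb_pow_sub_pow hq (hj j)
    have h3 := logb_pow_sub_pow_le hq (hD j)
    have h4 := le_logb_pow_sub_pow hq (hD j)
    have h5 : ((2 * n - j : ℕ) : ℝ) = 2 * n - j := by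
      rw [Nat.cast_sub (by have := hj j; omega)]
      push_cast
      rfl
    rw [h5] at h1 h2
    rw [abs_le]
    constructor <;> linarith
  have hmr : ∑ i, (a i : ℝ) = m := by rw [hm, Nat.cast_sum]
  have hmn : (m : ℝ) ≤ n := by exact_mod_cast ha
  have hm0 : (0 : ℝ) ≤ m := m.cast_nonneg
  rw [hsum, abs_le] at hbound
  rw [hmr, abs_le]
  constructor <;> linarith [hbound.1, hbound.2]

end Asymptotics

/-- Let `F` be a finite field with `q` elements and `P = (p₀,…,p_k)` a
rational probability vector with positive entries. Along the set `N_P` of positive integers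
`n` with each `n·pᵢ` an integer, `(1/n²)·log_q` of the number of isotropic flags of type
`(np₀, …, np_{k-1})` in `F^{2n}` tends to the symplectic entropy
`½·H₂(P) + ½·(1 - p_k²)`, where `H₂(P) = 1 - Σᵢ pᵢ²` is the Tsallis 2-entropy. -/
theorem symplectic_entropy_limit
    (F : Type*) [Field F] [Fintype F] (k : ℕ)
    (p : Fin (k + 1) → ℚ) (hp0 : ∀ i, 0 < p i) (hp1 : ∑ i, p i = 1) :
    Tendsto
      (fun n : ℕ =>
        (1 / (n : ℝ) ^ 2) *
          (Real.log (Nat.card {S : Fin k → Submodule F (Fin n ⊕ Fin n → F) |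
              (∀ i, IsTotallyIsotropic (S i)) ∧ Monotone S ∧
              ∀ i, Module.finrank F (S i) =
                ∑ j ∈ Finset.Iic i, ⌊(n : ℚ) * p j.castSucc⌋₊}) /
            Real.log (Fintype.card F)))
      (atTop ⊓ 𝓟 {n : ℕ | 0 < n ∧ ∀ i, ∃ m : ℕ, (m : ℚ) = (n : ℚ) * p i})
      (nhds ((1 / 2) * (1 - ∑ i, (p i : ℝ) ^ 2) +
        (1 / 2) * (1 - (p (Fin.last k) : ℝ) ^ 2))) := by
  have hcast : ∑ i : Fin k, (p i.castSucc : ℝ) = 1 - p (Fin.last k) := by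
    rw [Fin.sum_univ_castSucc] at hp1
    have : ∑ i : Fin k, p i.castSucc = 1 - p (Fin.last k) := by linarith
    exact_mod_cast congrArg (Rat.cast : ℚ → ℝ) this
  rw [tendsto_iff_norm_sub_tendsto_zero]
  have hzero : Tendsto (fun n : ℕ => 2 / (n : ℝ))
      (atTop ⊓ 𝓟 {n : ℕ | 0 < n ∧ ∀ i, ∃ m : ℕ, (m : ℚ) = (n : ℚ) * p i}) (nhds 0) :=
    (tendsto_const_div_atTop_nhds_zero_nat 2).mono_left inf_le_left
  refine squeeze_zero' (Eventually.of_forall fun _ => norm_nonneg _) ?_ hzero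
  filter_upwards [mem_inf_of_right (mem_principal_self _)] with n hn
  obtain ⟨hn0, hn⟩ := hn
  have hn0' : (0 : ℝ) < n := by exact_mod_cast hn0
  have hfloor (i : Fin k) : ((⌊(n : ℚ) * p i.castSucc⌋₊ : ℕ) : ℝ) = n * p i.castSucc := by
    obtain ⟨m, hm⟩ := hn i.castSucc
    rw [← hm, Nat.floor_natCast]
    exact_mod_cast congrArg (Rat.cast : ℚ → ℝ) hm
  have hsum : ∑ i : Fin k, ((⌊(n : ℚ) * p i.castSucc⌋₊ : ℕ) : ℝ) = n * (1 - p (Fin.last k)) := by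
    simp only [hfloor]
    rw [← Finset.mul_sum, hcast]
  have hlast : (0 : ℝ) < p (Fin.last k) := by exact_mod_cast hp0 (Fin.last k)
  have hle : ∑ i : Fin k, ⌊(n : ℚ) * p i.castSucc⌋₊ ≤ n := by
    have : ∑ i : Fin k, ((⌊(n : ℚ) * p i.castSucc⌋₊ : ℕ) : ℝ) ≤ n := by
      rw [hsum]
      nlinarith
    exact_mod_cast this
  have key := abs_logb_natCard_isotropicFlags_sub_le F _ hle
  have hsq : ∑ i : Fin k, ((⌊(n : ℚ) * p i.castSucc⌋₊ : ℕ) : ℝ) ^ 2 =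
      n ^ 2 * ∑ i : Fin k, (p i.castSucc : ℝ) ^ 2 := by
    simp only [hfloor, mul_pow, Finset.mul_sum]
  rw [hsum, hsq, Nat.card_eq_fintype_card (α := F), Real.logb, isotropicFlags] at key
  rw [Fin.sum_univ_castSucc, Real.norm_eq_abs]
  generalize Real.log _ / Real.log _ = L at key ⊢
  calc _ = |1 / (n : ℝ) ^ 2 * (L - (2 * n * (n * (1 - p (Fin.last k))) -
        (n * (1 - p (Fin.last k))) ^ 2 - n ^ 2 * (∑ i : Fin k, (p i.castSucc : ℝ) ^ 2) / 2))| := by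
        congr 1
        field_simp
        ring
    _ ≤ 1 / (n : ℝ) ^ 2 * (2 * n) := by
        rw [abs_mul, abs_of_pos (by positivity)]
        gcongr
    _ = 2 / n := by field_simp
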